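/- For positive reals λ₂, λ₃, let s₁ = 1 + λ₂² + λ₃², s₂ = λ₂² + λ₃² + λ₂²·λ₃², s₃ = λ₂²·λ₃², and F(λ₂, λ₃) = (2/3)·((s₁³ − 4·s₁·s₂)/s₃ + 9). Then for every fixed λ > 0, the quantity F(λ, λ₃) − (2/(3λ²))·λ₃⁴ + (2(1+λ²)/(3λ²))·λ₃² tends to (2/(3λ²))·(−λ⁴ + 3λ² − 1) as λ₃ → ∞. -/

import Mathlib

open Real Filter

/-- Hitchin's formula for the η-invariant of the left-invariant metric
`α₁² + λ₂²α₂² + λ₃²α₃²` on the 3-sphere, in terms of the elementary symmetric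
functions `s₁, s₂, s₃` of `(1, λ₂², λ₃²)`. -/
noncomputable def hitchinEta (l2 l3 : ℝ) : ℝ :=
  let s1 : ℝ := 1 + l2 ^ 2 + l3 ^ 2
  let s2 : ℝ := l2 ^ 2 + l3 ^ 2 + l2 ^ 2 * l3 ^ 2
  let s3 : ℝ := l2 ^ 2 * l3 ^ 2
  (2 / 3) * ((s1 ^ 3 - 4 * s1 * s2) / s3 + 9)

/-- The diabatic (renormalized) limit of Hitchin's η-invariant: subtracting the
divergent terms, the constant term as `λ₃ → ∞` is `(2/(3λ²))(−λ⁴ + 3λ² − 1)`. -/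
theorem hitchinEta_diabatic_limit (l : ℝ) (hl : 0 < l) :
    Tendsto (fun l3 : ℝ =>
        hitchinEta l l3 - (2 / (3 * l ^ 2)) * l3 ^ 4
          + (2 * (1 + l ^ 2) / (3 * l ^ 2)) * l3 ^ 2)
      atTop (nhds ((2 / (3 * l ^ 2)) * (-l ^ 4 + 3 * l ^ 2 - 1))) := by
  have h_inv : Tendsto (fun x : ℝ => (x ^ 2)⁻¹) atTop (nhds 0) :=
    (tendsto_pow_atTop two_ne_zero).inv_tendsto_atTop
  have h_lim := (h_inv.const_mul
    (2 / (3 * l ^ 2) * ((1 + l ^ 2) ^ 3 - 4 * (1 + l ^ 2) * l ^ 2))).const_add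
    ((2 / (3 * l ^ 2)) * (-l ^ 4 + 3 * l ^ 2 - 1))
  rw [mul_zero, add_zero] at h_lim
  refine h_lim.congr' ?_
  filter_upwards [eventually_gt_atTop 0] with x hx
  simp only [hitchinEta]
  field_simp
  ring
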